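/- For all real numbers θ, k, m, j one has sin(m·(j + 1)·θ)·sin(k·(j + 2)·θ) − sin(m·(j − 1)·θ)·sin(k·(j − 2)·θ) = sin((2k + m)·θ)·sin((k + m)·j·θ) − sin((2k − m)·θ)·sin((k − m)·j·θ). -/

import Mathlib

open Real

/-- Trigonometric identity (35): it forces the coefficients
`t_j = sin(m(j+1)π/(2n+1))` in the sine transform of the commutators
`[e_j, e_{j+1}]` used to approximate `i(L_m − L_{-m})`. -/
theorem sin_sin_transform_identity (θ k m j : ℝ) :
    sin (m * (j + 1) * θ) * sin (k * (j + 2) * θ)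
      - sin (m * (j - 1) * θ) * sin (k * (j - 2) * θ)
    = sin ((2 * k + m) * θ) * sin ((k + m) * j * θ)
      - sin ((2 * k - m) * θ) * sin ((k - m) * j * θ) := by
  have P : ∀ x y : ℝ, sin x * sin y = (cos (x - y) - cos (x + y)) / 2 := by
    intro x y
    rw [cos_sub, cos_add]
    ring
  rw [P, P, P, P]
  have h1 : cos ((2 * k + m) * θ - (k + m) * j * θ)
      = cos (m * (j - 1) * θ + k * (j - 2) * θ) := by
    rw [← cos_neg]
    congr 1
    ring
  have h2 : cos ((2 * k + m) * θ + (k + m) * j * θ)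
      = cos (m * (j + 1) * θ + k * (j + 2) * θ) := by
    congr 1
    ring
  have h3 : cos ((2 * k - m) * θ - (k - m) * j * θ)
      = cos (m * (j - 1) * θ - k * (j - 2) * θ) := by
    congr 1
    ring
  have h4 : cos ((2 * k - m) * θ + (k - m) * j * θ)
      = cos (m * (j + 1) * θ - k * (j + 2) * θ) := by
    rw [← cos_neg]
    congr 1
    ring
  rw [h1, h2, h3, h4]
  ring
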